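/- arXiv:1603.07666 — 8 statements merged into one kernel-verified Lean document; each statement's English description precedes it below -/
import Mathlib

section
/- Let G be a group, S a finite subset of G, and (z_h)_{h∈S} a family of nonzero complex numbers such that for every g ∈ G with g ≠ e, the sum over all ordered pairs (h, h') ∈ S × S with h·h'⁻¹ = g of z_h · conj(z_{h'}) equals 0. Then for every ordered pair (h₁, h₂) ∈ S × S with h₁ ≠ h₂, there exists an ordered pair (h₃, h₄) ∈ S × S with (h₃, h₄) ≠ (h₁, h₂) and h₃·h₄⁻¹ = h₁·h₂⁻¹ (the quadrangularity condition). -/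
open Finset

/-- **Quadrangularity condition.**
If `(z h)_{h ∈ S}` is a family of nonzero complex numbers such that for every `g ≠ e`
the sum of `z h * conj (z h')` over ordered pairs `(h, h') ∈ S × S` with `h * h'⁻¹ = g`
vanishes, then every ordered pair `(h₁, h₂) ∈ S × S` with `h₁ ≠ h₂` admits a different
ordered pair `(h₃, h₄) ∈ S × S` with `h₃ * h₄⁻¹ = h₁ * h₂⁻¹`. -/
theorem quadrangularity {G : Type*} [Group G] [DecidableEq G]
    (S : Finset G) (z : G → ℂ)
    (hz : ∀ h ∈ S, z h ≠ 0)
    (hunit : ∀ g : G, g ≠ 1 →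
      ∑ p ∈ (S ×ˢ S).filter (fun p => p.1 * p.2⁻¹ = g),
        z p.1 * (starRingEnd ℂ) (z p.2) = 0) :
    ∀ h₁ ∈ S, ∀ h₂ ∈ S, h₁ ≠ h₂ →
      ∃ h₃ ∈ S, ∃ h₄ ∈ S, (h₃, h₄) ≠ (h₁, h₂) ∧ h₃ * h₄⁻¹ = h₁ * h₂⁻¹ := by
  intro h₁ hh₁ h₂ hh₂ hne
  have hsum := hunit (h₁ * h₂⁻¹) (mt mul_inv_eq_one.mp hne)
  have hterm : z h₁ * (starRingEnd ℂ) (z h₂) ≠ 0 :=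
    mul_ne_zero (hz h₁ hh₁) ((map_ne_zero _).mpr (hz h₂ hh₂))
  by_contra! hunique
  refine hterm ((Finset.sum_eq_single_of_mem (h₁, h₂) (by simp [hh₁, hh₂]) ?_).symm.trans hsum)
  rintro ⟨a, b⟩ hab hab_ne
  simp only [Finset.mem_filter, Finset.mem_product] at hab
  exact absurd hab.2 (hunique a hab.1.1 b hab.1.2 hab_ne)
end

section
/- Let G be a group and z : G → ℂ a finitely supported function with support S. There exists a unitary operator A on ℓ²(G) (the Hilbert space lp of square-summable complex functions on G) satisfying (Aψ)(g) = Σ_{h∈S} z_h · ψ(g·h) for all ψ ∈ ℓ²(G) and all g ∈ G, if and only if z satisfies the unitarity conditions: Σ_{h∈S} |z_h|² = 1, and for every g ∈ G with g ≠ e, Σ_{(h,h')∈S×S, h·h'⁻¹ = g} z_h · conj(z_{h'}) = 0 and Σ_{(h,h')∈S×S, h⁻¹·h' = g} conj(z_h) · z_{h'} = 0. -/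
open Finset

/-- Right translation by `h` on `ℓ²(G)`, given by `(rightTranslation h ψ) g = ψ (g * h)`. -/
noncomputable def rightTranslation {G : Type*} [Group G] (h : G) :
    lp (fun _ : G => ℂ) 2 →L[ℂ] lp (fun _ : G => ℂ) 2 :=
  LinearIsometry.toContinuousLinearMap
    { toFun := fun ψ => ⟨fun g => ψ (g * h), memℓp_gen
        ((Equiv.mulRight h).summable_iff.2 ((lp.memℓp ψ).summable (by norm_num)))⟩
      map_add' := fun _ _ => rfl
      map_smul' := fun _ _ => rfl
      norm_map' := fun ψ => by
        have hp : 0 < (2 : ENNReal).toReal := by norm_num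
        rw [lp.norm_eq_tsum_rpow hp, lp.norm_eq_tsum_rpow hp]
        congr 1
        exact (Equiv.mulRight h).tsum_eq fun g => ‖ψ g‖ ^ (2 : ENNReal).toReal }

section rightTranslation

variable {G : Type*} [Group G]

@[simp]
theorem rightTranslation_apply (h : G) (ψ : lp (fun _ : G => ℂ) 2) (g : G) :
    rightTranslation h ψ g = ψ (g * h) :=
  rfl

theorem rightTranslation_one : rightTranslation (1 : G) = 1 := by
  ext ψ g
  simp

theorem rightTranslation_mul (h k : G) :
    rightTranslation (h * k) = rightTranslation h * rightTranslation k := by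
  ext ψ g
  simp [mul_assoc]

theorem star_rightTranslation (h : G) : star (rightTranslation h) = rightTranslation h⁻¹ := by
  rw [ContinuousLinearMap.star_eq_adjoint, eq_comm, ContinuousLinearMap.eq_adjoint_iff]
  intro φ ψ
  rw [lp.inner_eq_tsum, lp.inner_eq_tsum, ← (Equiv.mulRight h).tsum_eq]
  simp

theorem sum_smul_rightTranslation_apply {ι : Type*} (s : Finset ι) (c : ι → ℂ) (f : ι → G)
    (ψ : lp (fun _ : G => ℂ) 2) (g : G) :
    (∑ i ∈ s, c i • rightTranslation (f i)) ψ g = ∑ i ∈ s, c i * ψ (g * f i) := by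
  rw [_root_.sum_apply, lp.coeFn_sum, Finset.sum_apply]
  simp

/-- A finite combination of right translations is the identity iff the coefficients of each
translation add up to those of the identity: translations are linearly independent. -/
theorem sum_smul_rightTranslation_eq_one_iff [DecidableEq G] {ι : Type*} (s : Finset ι)
    (c : ι → ℂ) (f : ι → G) :
    ∑ i ∈ s, c i • rightTranslation (f i) = 1 ↔
      ∀ g : G, ∑ i ∈ s with f i = g, c i = if g = 1 then 1 else 0 := by
  constructor
  · intro H g
    have := congr($H (lp.single 2 1 1) g⁻¹)
    rw [sum_smul_rightTranslation_apply] at this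
    simpa [Pi.single_apply, Finset.sum_filter, inv_mul_eq_one, eq_comm] using this
  · intro H
    have hfiber (g : G) : ∑ i ∈ s with f i = g, c i • rightTranslation (f i) =
        (if g = 1 then (1 : ℂ) else 0) • rightTranslation g := by
      rw [← H g, Finset.sum_smul]
      exact Finset.sum_congr rfl fun i hi => by rw [(Finset.mem_filter.1 hi).2]
    rw [← Finset.sum_fiberwise_of_maps_to (t := insert 1 (s.image f)) (g := f)
      fun i hi => Finset.mem_insert_of_mem (Finset.mem_image_of_mem f hi)]
    simp [hfiber, rightTranslation_one]

end rightTranslation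

/-- The walk operator on `ℓ²(G)` with transition scalars `z`. -/
noncomputable def walkOperator {G : Type*} [Group G] (z : G →₀ ℂ) :
    lp (fun _ : G => ℂ) 2 →L[ℂ] lp (fun _ : G => ℂ) 2 :=
  ∑ h ∈ z.support, z h • rightTranslation h

section walkOperator

variable {G : Type*} [Group G] (z : G →₀ ℂ)

theorem walkOperator_apply (ψ : lp (fun _ : G => ℂ) 2) (g : G) :
    walkOperator z ψ g = ∑ h ∈ z.support, z h * ψ (g * h) :=
  sum_smul_rightTranslation_apply z.support z id ψ g

theorem star_walkOperator :
    star (walkOperator z) = ∑ h ∈ z.support, (starRingEnd ℂ) (z h) • rightTranslation h⁻¹ := by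
  simp [walkOperator, star_sum, star_smul, star_rightTranslation]

theorem walkOperator_mul_star :
    walkOperator z * star (walkOperator z) = ∑ p ∈ z.support ×ˢ z.support,
      (z p.1 * (starRingEnd ℂ) (z p.2)) • rightTranslation (p.1 * p.2⁻¹) := by
  rw [star_walkOperator, walkOperator, Finset.sum_mul_sum, Finset.sum_product]
  simp only [smul_mul_smul_comm, rightTranslation_mul]

theorem star_mul_walkOperator :
    star (walkOperator z) * walkOperator z = ∑ p ∈ z.support ×ˢ z.support,
      ((starRingEnd ℂ) (z p.1) * z p.2) • rightTranslation (p.1⁻¹ * p.2) := by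
  rw [star_walkOperator, walkOperator, Finset.sum_mul_sum, Finset.sum_product]
  simp only [smul_mul_smul_comm, rightTranslation_mul]

theorem exists_linearIsometryEquiv_iff_walkOperator_mem_unitary :
    (∃ A : lp (fun _ : G => ℂ) 2 ≃ₗᵢ[ℂ] lp (fun _ : G => ℂ) 2,
        ∀ ψ : lp (fun _ : G => ℂ) 2, ∀ g : G,
          A ψ g = ∑ h ∈ z.support, z h * ψ (g * h)) ↔
      walkOperator z ∈ unitary (lp (fun _ : G => ℂ) 2 →L[ℂ] lp (fun _ : G => ℂ) 2) := by
  constructor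
  · rintro ⟨A, hA⟩
    have : walkOperator z = (Unitary.linearIsometryEquiv.symm A).1 := by
      ext ψ g
      exact (walkOperator_apply z ψ g).trans (hA ψ g).symm
    rw [this]
    exact (Unitary.linearIsometryEquiv.symm A).2
  · intro hz
    exact ⟨Unitary.linearIsometryEquiv ⟨walkOperator z, hz⟩, walkOperator_apply z⟩

variable [DecidableEq G]

theorem sum_mul_conj_filter_mul_inv_eq_one :
    ∑ p ∈ (z.support ×ˢ z.support).filter (fun p => p.1 * p.2⁻¹ = 1),
      z p.1 * (starRingEnd ℂ) (z p.2) = ((∑ h ∈ z.support, ‖z h‖ ^ 2 : ℝ) : ℂ) := by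
  rw [Finset.sum_filter, Finset.sum_product]
  simp +contextual [mul_inv_eq_one, Complex.mul_conj']

theorem sum_conj_mul_filter_inv_mul_eq_one :
    ∑ p ∈ (z.support ×ˢ z.support).filter (fun p => p.1⁻¹ * p.2 = 1),
      (starRingEnd ℂ) (z p.1) * z p.2 = ((∑ h ∈ z.support, ‖z h‖ ^ 2 : ℝ) : ℂ) := by
  rw [Finset.sum_filter, Finset.sum_product]
  simp +contextual [inv_mul_eq_one, Complex.conj_mul']

end walkOperator

/-- For a finitely supported `z : G →₀ ℂ`, there exists a unitary operator `A` on `ℓ²(G)`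
acting as `(A ψ) g = ∑ h ∈ S, z h * ψ (g * h)` (with `S` the support of `z`) if and only if
the unitarity conditions hold: `∑ |z h|² = 1`, and for every `g ≠ e` the two sums
`∑_{h h'⁻¹ = g} z h conj (z h')` and `∑_{h⁻¹ h' = g} conj (z h) z h'` over pairs of the
support vanish. -/
theorem unitarity_conditions_iff {G : Type*} [Group G] [DecidableEq G] (z : G →₀ ℂ) :
    (∃ A : lp (fun _ : G => ℂ) 2 ≃ₗᵢ[ℂ] lp (fun _ : G => ℂ) 2,
        ∀ ψ : lp (fun _ : G => ℂ) 2, ∀ g : G,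
          A ψ g = ∑ h ∈ z.support, z h * ψ (g * h)) ↔
      ((∑ h ∈ z.support, ‖z h‖ ^ 2 = 1) ∧
        ∀ g : G, g ≠ 1 →
          (∑ p ∈ (z.support ×ˢ z.support).filter (fun p => p.1 * p.2⁻¹ = g),
              z p.1 * (starRingEnd ℂ) (z p.2) = 0) ∧
          (∑ p ∈ (z.support ×ˢ z.support).filter (fun p => p.1⁻¹ * p.2 = g),
              (starRingEnd ℂ) (z p.1) * z p.2 = 0)) := by
  rw [exists_linearIsometryEquiv_iff_walkOperator_mem_unitary, Unitary.mem_iff,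
    star_mul_walkOperator, walkOperator_mul_star, sum_smul_rightTranslation_eq_one_iff,
    sum_smul_rightTranslation_eq_one_iff]
  constructor
  · rintro ⟨hl, hr⟩
    refine ⟨?_, fun g hg => ⟨by simpa [hg] using hr g, by simpa [hg] using hl g⟩⟩
    have h := hr 1
    rw [sum_mul_conj_filter_mul_inv_eq_one, if_pos rfl] at h
    exact_mod_cast h
  · rintro ⟨hnorm, hoff⟩
    refine ⟨fun g => ?_, fun g => ?_⟩
    · rcases eq_or_ne g 1 with rfl | hg
      · rw [sum_conj_mul_filter_inv_mul_eq_one, hnorm, if_pos rfl, Complex.ofReal_one]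
      · rw [(hoff g hg).2, if_neg hg]
    · rcases eq_or_ne g 1 with rfl | hg
      · rw [sum_mul_conj_filter_mul_inv_eq_one, hnorm, if_pos rfl, Complex.ofReal_one]
      · rw [(hoff g hg).1, if_neg hg]
end

section
/- Let d ≥ 1, let S be a finite subset of the Euclidean space ℝ^d, and let v ∈ ℝ^d with v ≠ 0 be such that ‖v‖ = max over all pairs (h, h') ∈ S × S of ‖h − h'‖. If v = h₁ − h₂ = h₃ − h₄ with h₁, h₂, h₃, h₄ ∈ S, then h₁ = h₃ and h₂ = h₄; that is, v is realized as a difference of elements of S by a unique ordered pair. -/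
/-- In a real inner product space, if neither `v + w` nor `v - w` is longer than `v`,
then `w = 0`. -/
theorem eq_zero_of_norm_add_le_of_norm_sub_le {E : Type*} [NormedAddCommGroup E]
    [InnerProductSpace ℝ E] {v w : E} (hadd : ‖v + w‖ ≤ ‖v‖) (hsub : ‖v - w‖ ≤ ‖v‖) :
    w = 0 := by
  have hpar := parallelogram_law_with_norm ℝ v w
  have hadd_sq := mul_self_le_mul_self (norm_nonneg _) hadd
  have hsub_sq := mul_self_le_mul_self (norm_nonneg _) hsub
  have hw : ‖w‖ * ‖w‖ = 0 := le_antisymm (by linarith) (mul_self_nonneg _)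
  exact norm_eq_zero.mp (mul_self_eq_zero.mp hw)

/-- If `v ≠ 0` realizes the maximal norm among all differences of pairs of elements of a
finite subset `S` of `ℝᵈ`, then the ordered pair realizing `v` as a difference is unique:
`v = h₁ - h₂ = h₃ - h₄` with `h₁, h₂, h₃, h₄ ∈ S` implies `h₁ = h₃` and `h₂ = h₄`. -/
theorem max_difference_pair_unique {d : ℕ} (hd : 1 ≤ d)
    (S : Finset (EuclideanSpace ℝ (Fin d))) (v : EuclideanSpace ℝ (Fin d))
    (hv : v ≠ 0)
    (hmax : ∀ h ∈ S, ∀ h' ∈ S, ‖h - h'‖ ≤ ‖v‖)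
    (h₁ h₂ h₃ h₄ : EuclideanSpace ℝ (Fin d))
    (hh₁ : h₁ ∈ S) (hh₂ : h₂ ∈ S) (hh₃ : h₃ ∈ S) (hh₄ : h₄ ∈ S)
    (e₁ : v = h₁ - h₂) (e₂ : v = h₃ - h₄) :
    h₁ = h₃ ∧ h₂ = h₄ := by
  have hadd : v + (h₁ - h₃) = h₁ - h₄ := by rw [e₂]; abel
  have hsub : v - (h₁ - h₃) = h₃ - h₂ := by rw [e₁]; abel
  have h₁₃ : h₁ = h₃ := sub_eq_zero.mp <|
    eq_zero_of_norm_add_le_of_norm_sub_le (hadd ▸ hmax h₁ hh₁ h₄ hh₄)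
      (hsub ▸ hmax h₃ hh₃ h₂ hh₂)
  refine ⟨h₁₃, ?_⟩
  rw [h₁₃] at e₁
  exact sub_right_injective (e₁.symm.trans e₂)
end

section
/- Let G be a non-commutative group containing a subgroup H of index 2 with H isomorphic to ℤ. Then G is isomorphic to the infinite dihedral group D∞ = ℤ ⋊ ℤ₂, where the nontrivial element of ℤ₂ acts on ℤ by inversion (in Mathlib terms, G ≃* DihedralGroup 0). -/
/-- The homomorphism from the infinite dihedral group determined by elements `a` and `s` with
`s ^ 2 = 1` and `s * a * s⁻¹ = a⁻¹`. -/
def DihedralGroup.liftInfinite {G : Type*} [Group G] (a s : G) (hs : s * s = 1)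
    (hsa : s * a * s⁻¹ = a⁻¹) : DihedralGroup 0 →* G :=
  have hconj (i : ℤ) : a ^ i * s = s * a ^ (-i) := by
    rw [zpow_neg, ← inv_zpow, ← hsa, conj_zpow, inv_eq_of_mul_eq_one_right hs]
    simp only [← mul_assoc, hs, one_mul]
  have hrs (i j : ℤ) : s * a ^ (j - i) = a ^ i * (s * a ^ j) := by
    rw [← mul_assoc, hconj, mul_assoc, ← zpow_add, neg_add_eq_sub]
  have hsr (i j : ℤ) : s * a ^ (i + j) = s * a ^ i * a ^ j := by
    rw [mul_assoc, zpow_add]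
  have hss (i j : ℤ) : a ^ (j - i) = s * a ^ i * (s * a ^ j) := by
    rw [mul_assoc, ← hrs, ← mul_assoc, hs, one_mul]
  { toFun
      | .r i => a ^ (show ℤ from i)
      | .sr i => s * a ^ (show ℤ from i)
    map_one' := zpow_zero a
    map_mul' := by
      rintro (i | i) (j | j)
      · exact zpow_add a i j
      · exact hrs i j
      · exact hsr i j
      · exact hss i j }

/-- An element normalizing an infinite cyclic subgroup centralizes or inverts its generator. -/
theorem conj_eq_self_or_inv_of_zpow_injective {G : Type*} [Group G] {a : G}
    (ha : Function.Injective fun n : ℤ => a ^ n) [hN : (Subgroup.zpowers a).Normal] (s : G) :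
    s * a * s⁻¹ = a ∨ s * a * s⁻¹ = a⁻¹ := by
  obtain ⟨k, hk⟩ := Subgroup.mem_zpowers_iff.mp
    (hN.conj_mem a (Subgroup.mem_zpowers a) s)
  obtain ⟨l, hl⟩ := Subgroup.mem_zpowers_iff.mp
    (hN.conj_mem a (Subgroup.mem_zpowers a) s⁻¹)
  have hkl : k * l = 1 := ha <| by
    change a ^ (k * l) = a ^ (1 : ℤ)
    rw [zpow_mul, hk, conj_zpow, hl]
    group
  rcases Int.eq_one_or_neg_one_of_mul_eq_one hkl with rfl | rfl
  · exact Or.inl (by simpa using hk.symm)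
  · exact Or.inr (by simpa using hk.symm)

/-- A group with an index-two cyclic subgroup is the union of that subgroup and the coset of any
element outside it. -/
theorem eq_zpow_or_eq_mul_zpow_of_index_eq_two {G : Type*} [Group G] {a s : G}
    (hindex : (Subgroup.zpowers a).index = 2) (hs : s ∉ Subgroup.zpowers a) (x : G) :
    ∃ i : ℤ, x = a ^ i ∨ x = s * a ^ i := by
  by_cases hx : x ∈ Subgroup.zpowers a
  · obtain ⟨i, rfl⟩ := hx
    exact ⟨i, Or.inl rfl⟩
  · obtain ⟨i, hi⟩ : s⁻¹ * x ∈ Subgroup.zpowers a := by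
      rw [Subgroup.mul_mem_iff_of_index_two hindex, inv_mem_iff]
      exact iff_of_false hs hx
    exact ⟨i, Or.inr (eq_inv_mul_iff_mul_eq.mp hi).symm⟩

/-- A group with an index-two cyclic subgroup is commutative once some element outside the
subgroup commutes with a generator. -/
theorem mul_comm_of_index_zpowers_eq_two {G : Type*} [Group G] {a s : G}
    (hindex : (Subgroup.zpowers a).index = 2) (hs : s ∉ Subgroup.zpowers a)
    (hsa : Commute s a) (x y : G) : x * y = y * x := by
  have hform := eq_zpow_or_eq_mul_zpow_of_index_eq_two hindex hs
  have haa (i j : ℤ) : Commute (a ^ i) (a ^ j) := Commute.zpow_zpow_self a i j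
  have hsz (i : ℤ) : Commute s (a ^ i) := hsa.zpow_right i
  change Commute x y
  obtain ⟨i, rfl | rfl⟩ := hform x <;> obtain ⟨j, rfl | rfl⟩ := hform y
  · exact haa i j
  · exact (hsz i).symm.mul_right (haa i j)
  · exact (hsz j).mul_left (haa i j)
  · exact ((Commute.refl s).mul_right (hsz j)).mul_left ((hsz i).symm.mul_right (haa i j))

/-- A non-commutative group containing `ℤ` as an index-2 subgroup is isomorphic to the
infinite dihedral group `D∞ = ℤ ⋊ ℤ₂` (in Mathlib terms, `DihedralGroup 0`). -/
theorem index_two_infinite_cyclic_is_dihedral {G : Type*} [Group G]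
    (hG : ¬ ∀ a b : G, a * b = b * a)
    (H : Subgroup G) (hindex : H.index = 2)
    (hH : Nonempty (H ≃* Multiplicative ℤ)) :
    Nonempty (G ≃* DihedralGroup 0) := by
  obtain ⟨e⟩ := hH
  obtain ⟨a, hpow⟩ : ∃ a : G, ∀ n : ℤ, a ^ n = e.symm (Multiplicative.ofAdd n) := by
    refine ⟨e.symm (Multiplicative.ofAdd 1), fun n => ?_⟩
    rw [← Subgroup.coe_zpow, ← map_zpow, ← ofAdd_zsmul, smul_eq_mul, mul_one]
  have ha : Function.Injective fun n : ℤ => a ^ n := fun m n hmn => by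
    simpa [hpow] using hmn
  obtain rfl : H = Subgroup.zpowers a := by
    ext x
    rw [Subgroup.mem_zpowers_iff]
    constructor
    · intro hx
      exact ⟨(e ⟨x, hx⟩).toAdd, by simp [hpow]⟩
    · rintro ⟨n, rfl⟩
      rw [hpow]
      exact SetLike.coe_mem _
  have hN := Subgroup.normal_of_index_eq_two hindex
  obtain ⟨s, hs⟩ : ∃ s, s ∉ Subgroup.zpowers a := by
    by_contra! hall
    simp [(Subgroup.eq_top_iff' _).mpr hall] at hindex
  have hsa : s * a * s⁻¹ = a⁻¹ := (conj_eq_self_or_inv_of_zpow_injective ha s).resolve_left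
    fun h => hG (mul_comm_of_index_zpowers_eq_two hindex hs (mul_inv_eq_iff_eq_mul.mp h))
  have hss : s * s = 1 := by
    obtain ⟨m, hm⟩ := Subgroup.mem_zpowers_iff.mp (Subgroup.mul_self_mem_of_index_two hindex s)
    have hneg : -m = m := ha <| by
      change a ^ (-m) = a ^ m
      rw [zpow_neg, ← inv_zpow, ← hsa, conj_zpow, hm]
      group
    rw [← hm, show m = 0 by lia, zpow_zero]
  refine ⟨(MulEquiv.ofBijective (DihedralGroup.liftInfinite a s hss hsa) ⟨?_, ?_⟩).symm⟩
  · rw [injective_iff_map_eq_one]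
    rintro (i | i) hi
    · exact congrArg DihedralGroup.r (ha (hi.trans (zpow_zero a).symm))
    · have hi' : s * a ^ (show ℤ from i) = 1 := hi
      refine absurd ?_ hs
      rw [eq_inv_of_mul_eq_one_left hi', inv_mem_iff]
      exact Subgroup.zpow_mem_zpowers a _
  · intro x
    obtain ⟨i, rfl | rfl⟩ := eq_zpow_or_eq_mul_zpow_of_index_eq_two hindex hs x
    · exact ⟨.r i, rfl⟩
    · exact ⟨.sr i, rfl⟩
end

section
/- Let D∞ be the infinite dihedral group generated by a and r with relations r² = e and r·a·r⁻¹ = a⁻¹, and for n ∈ ℤ let S = {e, a^{n−1}·r, a^{n}·r, a^{n+1}·r}. Then there is no family of nonzero complex numbers (z_h)_{h∈S} satisfying the unitarity conditions: Σ_{h∈S} |z_h|² = 1 and, for every g ≠ e, Σ_{(h,h')∈S×S, h·h'⁻¹ = g} z_h · conj(z_{h'}) = 0 and Σ_{(h,h')∈S×S, h⁻¹·h' = g} conj(z_h) · z_{h'} = 0. In particular, no scalar quantum walk exists on the Cayley graph Γ(D∞, S); this rules out generating sets of D∞ not containing a. -/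
open Finset

/-- In `D∞`, the reflection `a ^ m * r` is `sr (-m)`. -/
theorem DihedralGroup.r_one_zpow_mul_sr_zero (m : ℤ) :
    (DihedralGroup.r 1 : DihedralGroup 0) ^ m * DihedralGroup.sr 0 =
      DihedralGroup.sr (-(Int.cast m : ZMod 0)) := by
  simp

/-- No scalar quantum walk exists on a Cayley graph of the infinite dihedral group
`D∞ = ⟨a, r | r² = e, r a r⁻¹ = a⁻¹⟩` with generating set
`S = {e, a^(n-1) r, a^n r, a^(n+1) r}` (three consecutive reflections and the identity):
there is no family of nonzero complex numbers `(z h)_{h ∈ S}` satisfying the unitarity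
conditions. This rules out generating sets of `D∞` not containing `a`. -/
theorem no_scalar_qw_without_a (n : ℤ)
    (a r : DihedralGroup 0)
    (ha : a = DihedralGroup.r 1) (hr : r = DihedralGroup.sr 0) :
    ¬ ∃ z : DihedralGroup 0 → ℂ,
      (∀ h ∈ ({1, a ^ (n - 1) * r, a ^ n * r, a ^ (n + 1) * r} :
          Finset (DihedralGroup 0)), z h ≠ 0) ∧
      (∑ h ∈ ({1, a ^ (n - 1) * r, a ^ n * r, a ^ (n + 1) * r} :
          Finset (DihedralGroup 0)), ‖z h‖ ^ 2 = 1) ∧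
      (∀ g : DihedralGroup 0, g ≠ 1 →
        (∑ p ∈ ((({1, a ^ (n - 1) * r, a ^ n * r, a ^ (n + 1) * r} :
              Finset (DihedralGroup 0)) ×ˢ
            ({1, a ^ (n - 1) * r, a ^ n * r, a ^ (n + 1) * r} :
              Finset (DihedralGroup 0))).filter (fun p => p.1 * p.2⁻¹ = g)),
            z p.1 * (starRingEnd ℂ) (z p.2) = 0) ∧
        (∑ p ∈ ((({1, a ^ (n - 1) * r, a ^ n * r, a ^ (n + 1) * r} :
              Finset (DihedralGroup 0)) ×ˢ
            ({1, a ^ (n - 1) * r, a ^ n * r, a ^ (n + 1) * r} :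
              Finset (DihedralGroup 0))).filter (fun p => p.1⁻¹ * p.2 = g)),
            (starRingEnd ℂ) (z p.1) * z p.2 = 0)) := by
  subst ha hr
  rintro ⟨z, hz, -, hu⟩
  simp only [DihedralGroup.r_one_zpow_mul_sr_zero, Int.cast_sub, Int.cast_add,
    Int.cast_one] at hz hu
  generalize (Int.cast n : ZMod 0) = k at hz hu
  have h := (hu (DihedralGroup.r 2) (by
    rw [DihedralGroup.one_def, Ne, DihedralGroup.r.injEq]; decide)).1
  -- the only pair with quotient `a ^ 2` consists of the two outermost reflections
  rw [Finset.sum_eq_single_of_mem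
    (DihedralGroup.sr (-(k + 1)), DihedralGroup.sr (-(k - 1)))] at h
  · rcases mul_eq_zero.1 h with h | h
    · exact hz _ (by simp) h
    · exact hz _ (by simp) ((map_eq_zero _).1 h)
  · simp only [mem_filter, mem_product, mem_insert, mem_singleton, true_or, or_true, true_and,
      DihedralGroup.inv_sr, DihedralGroup.sr_mul_sr, DihedralGroup.r.injEq]
    ring
  · rintro ⟨x, y⟩ hp hne
    simp only [mem_filter, mem_product, mem_insert, mem_singleton] at hp
    obtain ⟨⟨hx, hy⟩, hg⟩ := hp
    exfalso
    rcases hx with rfl | rfl | rfl | rfl <;> rcases hy with rfl | rfl | rfl | rfl <;>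
      simp only [DihedralGroup.one_def, DihedralGroup.inv_sr, DihedralGroup.inv_r,
        DihedralGroup.sr_mul_sr, DihedralGroup.r_mul_r, DihedralGroup.sr_mul_r,
        DihedralGroup.r_mul_sr, DihedralGroup.r.injEq, reduceCtorEq, ne_eq,
        not_true_eq_false] at hg hne <;> grind
end

section
/- Let z_a, z_ā, z_b, z_c be nonzero complex numbers and z_d, z_e complex numbers, and for k ∈ ℝ define the 2×2 complex matrix A_k = e^{−ik}·[[z_a, z_b],[z_c, z_ā]] + e^{ik}·[[z_ā, z_c],[z_b, z_a]] + [[z_e, z_d],[z_d, z_e]]. If A_k is unitary for every k ∈ ℝ, then there exist γ ∈ ℝ, angles θ, θ' ∈ (−π/2, 0) ∪ (0, π/2), real numbers ν, μ ≥ 0 with ν² + μ² = 1, and a sign s ∈ {+1, −1} such that for all k ∈ ℝ: A_k = e^{iγ} · e^{iθσx} · A_k^D · e^{iθ'σx}, where σx = [[0,1],[1,0]], e^{iθσx} = (cos θ)·I + i(sin θ)·σx, and A_k^D = [[ν e^{−ik}, i s μ],[i s μ, ν e^{ik}]] is the one-dimensional Dirac quantum walk matrix. -/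
open Matrix

/-- The Pauli matrix σx. -/
def sigmaX : Matrix (Fin 2) (Fin 2) ℂ := !![0, 1; 1, 0]

/-- The matrix exponential `e^{iθσx} = cos θ · I + i sin θ · σx`. -/
noncomputable def expISigmaX (θ : ℝ) : Matrix (Fin 2) (Fin 2) ℂ :=
  (Real.cos θ : ℂ) • (1 : Matrix (Fin 2) (Fin 2) ℂ) +
    (Complex.I * (Real.sin θ : ℂ)) • sigmaX

/-- The one-dimensional Dirac quantum walk matrix `A_k^D`. -/
noncomputable def diracQW (ν μ s k : ℝ) : Matrix (Fin 2) (Fin 2) ℂ :=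
  !![(ν : ℂ) * Complex.exp (-(Complex.I * (k : ℂ))), Complex.I * (s : ℂ) * (μ : ℂ);
     Complex.I * (s : ℂ) * (μ : ℂ), (ν : ℂ) * Complex.exp (Complex.I * (k : ℂ))]

/-- A Laurent polynomial of degree at most two vanishing on the unit circle has vanishing
extreme coefficients. -/
lemma laurent_extreme_coeffs_eq_zero {a b c d e : ℂ}
    (h : ∀ w : ℂ, w * star w = 1 →
      a * w ^ 2 + b * w + c + d * star w + e * star w ^ 2 = 0) : a = 0 ∧ e = 0 := by
  have h₁ := h 1 (by simp)
  have h₂ := h (-1) (by simp)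
  have h₃ := h Complex.I (by simp)
  have h₄ := h (-Complex.I) (by simp)
  have h₅ := h (3 / 5 + 4 / 5 * Complex.I) (by
    simp [Complex.ext_iff]; norm_num)
  have hs : star (3 / 5 + 4 / 5 * Complex.I) = 3 / 5 - 4 / 5 * Complex.I := by
    simp [Complex.ext_iff]
  rw [hs] at h₅
  simp only [star_one, star_neg, Complex.star_def, Complex.conj_I] at h₁ h₂ h₃ h₄
  have hI := Complex.I_sq
  have hsum : a + e = 0 := by
    linear_combination (h₁ + h₂ - h₃ - h₄) / 4 + (a + e) / 2 * hI
  have hc : c = 0 := by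
    linear_combination (h₁ + h₂ + h₃ + h₄) / 4 - (a + e) / 2 * hI
  have hbd : b + d = 0 := by
    linear_combination (h₁ - h₂) / 2
  have hbd' : b - d = 0 := by
    linear_combination -Complex.I * (h₃ - h₄) / 2 + (b - d) * hI
  have hb : b = 0 := by linear_combination (hbd + hbd') / 2
  have hd : d = 0 := by linear_combination (hbd - hbd') / 2
  have he : e = -a := by linear_combination hsum
  subst hb hc hd he
  have ha : a * Complex.I = 0 := by linear_combination 25 / 48 * h₅
  have ha : a = 0 := by simpa using ha
  simp [ha]

/-- Two complex numbers that are orthogonal over the reals differ by an imaginary factor. -/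
lemma exists_eq_I_mul_real_mul {z w : ℂ} (hz : z ≠ 0) (h : z * star w + w * star z = 0) :
    ∃ t : ℝ, w = Complex.I * t * z := by
  refine ⟨(w / z).im, ?_⟩
  have hz' : star z ≠ 0 := star_ne_zero.mpr hz
  have hre : (w / z).re = 0 := by
    have h' : w / z + star (w / z) = 0 := by
      rw [star_div₀]
      field_simp
      linear_combination h
    have := congrArg Complex.re h'
    simp only [Complex.add_re, Complex.star_def, Complex.conj_re, Complex.zero_re] at this
    linarith
  have hq : w / z = Complex.I * ((w / z).im : ℂ) := by
    apply Complex.ext <;> simp [hre]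
  rw [← hq, div_mul_cancel₀ _ hz]

lemma exists_exp_I_mul_eq {w : ℂ} (hw : w * star w = 1) :
    ∃ k : ℝ, Complex.exp (Complex.I * k) = w := by
  refine ⟨w.arg, ?_⟩
  have hn : ‖w‖ = 1 := by
    have := congrArg norm hw
    rw [norm_mul, norm_star, norm_one] at this
    nlinarith [norm_nonneg w]
  have := Complex.norm_mul_exp_arg_mul_I w
  rwa [hn, Complex.ofReal_one, one_mul, mul_comm] at this

lemma exp_neg_I_mul (k : ℝ) :
    Complex.exp (-(Complex.I * k)) = star (Complex.exp (Complex.I * k)) := by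
  rw [Complex.star_def, ← Complex.exp_conj]
  simp

lemma expISigmaX_eq (θ : ℝ) : expISigmaX θ =
    !![(Real.cos θ : ℂ), Complex.I * Real.sin θ; Complex.I * Real.sin θ, (Real.cos θ : ℂ)] := by
  ext i j
  fin_cases i <;> fin_cases j <;> simp [expISigmaX, sigmaX]

lemma expISigmaX_mul_neg (θ : ℝ) : expISigmaX θ * expISigmaX (-θ) = 1 := by
  have h : (Real.cos θ : ℂ) ^ 2 + (Real.sin θ : ℂ) ^ 2 = 1 := by
    exact_mod_cast Real.cos_sq_add_sin_sq θ
  rw [expISigmaX_eq, expISigmaX_eq, Real.cos_neg, Real.sin_neg, Matrix.mul_fin_two,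
    Matrix.one_fin_two]
  ext i j
  fin_cases i <;> fin_cases j <;> simp [-Complex.ofReal_cos, -Complex.ofReal_sin]
  · linear_combination h - (Real.sin θ : ℂ) ^ 2 * Complex.I_sq
  · ring
  · ring
  · linear_combination h - (Real.sin θ : ℂ) ^ 2 * Complex.I_sq

lemma expISigmaX_neg_mul (θ : ℝ) : expISigmaX (-θ) * expISigmaX θ = 1 := by
  simpa using expISigmaX_mul_neg (-θ)

lemma star_expISigmaX (θ : ℝ) : star (expISigmaX θ) = expISigmaX (-θ) := by
  rw [expISigmaX_eq, expISigmaX_eq, Matrix.star_eq_conjTranspose]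
  ext i j
  fin_cases i <;> fin_cases j <;> simp [-Complex.ofReal_cos, -Complex.ofReal_sin]

lemma expISigmaX_mem_unitaryGroup (θ : ℝ) :
    expISigmaX θ ∈ Matrix.unitaryGroup (Fin 2) ℂ := by
  rw [Matrix.mem_unitaryGroup_iff, star_expISigmaX, expISigmaX_mul_neg]

lemma arctan_mem_of_ne_zero {t : ℝ} (ht : t ≠ 0) :
    Real.arctan t ∈ Set.Ioo (-(Real.pi / 2)) 0 ∪ Set.Ioo 0 (Real.pi / 2) := by
  rcases lt_or_gt_of_ne ht with h | h
  · exact Or.inl ⟨Real.neg_pi_div_two_lt_arctan t, Real.arctan_lt_zero.mpr h⟩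
  · exact Or.inr ⟨Real.arctan_pos.mpr h, Real.arctan_lt_pi_div_two t⟩

/-- The walk matrix as a function of the phase `w = e^{ik}`. -/
def dihedralWalk (za zaInv zb zc zd ze w : ℂ) : Matrix (Fin 2) (Fin 2) ℂ :=
  !![star w * za + w * zaInv + ze, star w * zb + w * zc + zd;
     star w * zc + w * zb + zd, star w * zaInv + w * za + ze]

/-- Unitarity on the whole circle forces the step matrix to have rank one. -/
lemma exists_real_of_dihedralWalk_unitary {za zaInv zb zc zd ze : ℂ}
    (hza : za ≠ 0)
    (hU : ∀ w : ℂ, w * star w = 1 →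
      dihedralWalk za zaInv zb zc zd ze w ∈ Matrix.unitaryGroup (Fin 2) ℂ) :
    ∃ t t' : ℝ, zb = Complex.I * t * za ∧ zc = Complex.I * t' * za ∧ zaInv = -(t * t') * za := by
  have hrow : za * star zb + zb * star za = 0 := by
    refine (laurent_extreme_coeffs_eq_zero (a := zaInv * star zc + zc * star zaInv)
      (b := zaInv * star zd + ze * star zc + zc * star ze + zd * star zaInv)
      (c := za * star zc + zaInv * star zb + ze * star zd + zb * star zaInv + zc * star za
        + zd * star ze)
      (d := za * star zd + ze * star zb + zb * star ze + zd * star za) fun w hw => ?_).2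
    have h := congrFun₂ (Matrix.mem_unitaryGroup_iff.mp (hU w hw)) 0 1
    simp [dihedralWalk, Matrix.mul_apply, Fin.sum_univ_two] at h
    simp only [← Complex.star_def] at h
    linear_combination h - (za * star zc + zaInv * star zb + zb * star zaInv + zc * star za) * hw
  have hcol : za * star zc + zc * star za = 0 := by
    refine (laurent_extreme_coeffs_eq_zero
      (b := zc * star ze + zd * star za + ze * star zc + za * star zd)
      (c := zb * star za + zc * star zaInv + zd * star ze + zaInv * star zc + za * star zb
        + ze * star zd)
      (d := zb * star ze + zd * star zaInv + ze * star zb + zaInv * star zd)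
      (e := zb * star zaInv + zaInv * star zb) fun w hw => ?_).1
    have h := congrFun₂ (Matrix.mem_unitaryGroup_iff'.mp (hU w hw)) 0 1
    simp [dihedralWalk, Matrix.mul_apply, Fin.sum_univ_two] at h
    simp only [← Complex.star_def] at h
    linear_combination h - (zb * star za + zc * star zaInv + zaInv * star zc + za * star zb) * hw
  have hdiag : zaInv * star za + zc * star zb = 0 := by
    refine (laurent_extreme_coeffs_eq_zero
      (b := zaInv * star ze + ze * star za + zc * star zd + zd * star zb)
      (c := za * star za + zaInv * star zaInv + ze * star ze
        + zb * star zb + zc * star zc + zd * star zd - 1)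
      (d := za * star ze + ze * star zaInv + zb * star zd + zd * star zc)
      (e := za * star zaInv + zb * star zc) fun w hw => ?_).1
    have h := congrFun₂ (Matrix.mem_unitaryGroup_iff.mp (hU w hw)) 0 0
    simp [dihedralWalk, Matrix.mul_apply, Fin.sum_univ_two] at h
    simp only [← Complex.star_def] at h
    linear_combination h - (za * star za + zaInv * star zaInv + zb * star zb + zc * star zc) * hw
  obtain ⟨t, ht⟩ := exists_eq_I_mul_real_mul hza hrow
  obtain ⟨t', ht'⟩ := exists_eq_I_mul_real_mul hza hcol
  refine ⟨t, t', ht, ht', mul_right_cancel₀ (star_ne_zero.mpr hza) ?_⟩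
  rw [ht, ht'] at hdiag
  simp at hdiag ⊢
  simp only [← Complex.star_def] at hdiag ⊢
  linear_combination hdiag + t * t' * za * star za * Complex.I_sq

/-- Conditions for `c (e^{-ik} ⊕ e^{ik}) + p + q σx` to be unitary on the whole circle. -/
lemma conditions_of_unitary {c p q : ℂ} (hc : c ≠ 0)
    (hU : ∀ w : ℂ, w * star w = 1 →
      !![c * star w + p, q; q, c * w + p] ∈ Matrix.unitaryGroup (Fin 2) ℂ) :
    p = 0 ∧ c * star q + q * star c = 0 ∧ c * star c + q * star q = 1 := by
  have h₀ : ∀ w : ℂ, w * star w = 1 →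
      (c * star w + p) * (star c * w + star p) + q * star q = 1 := fun w hw => by
    have h := congrFun₂ (Matrix.mem_unitaryGroup_iff.mp (hU w hw)) 0 0
    simpa [Matrix.mul_apply, Fin.sum_univ_two] using h
  have h₁ := h₀ 1 (by simp)
  have h₂ := h₀ (-1) (by simp)
  have h₃ := h₀ Complex.I (by simp)
  have h₄ := h₀ (-Complex.I) (by simp)
  have hI : star Complex.I = -Complex.I := Complex.conj_I
  simp only [star_one, star_neg, hI] at h₁ h₂ h₃ h₄
  have hp : p * star c = 0 := by
    linear_combination (h₁ - h₂ - Complex.I * (h₃ - h₄)) / 4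
      + (p * star c - c * star p) / 2 * Complex.I_sq
  obtain rfl : p = 0 := (mul_eq_zero.mp hp).resolve_right (star_ne_zero.mpr hc)
  have h := congrFun₂ (Matrix.mem_unitaryGroup_iff.mp (hU 1 (by simp))) 0 1
  refine ⟨rfl, ?_, ?_⟩
  · simpa [Matrix.mul_apply, Fin.sum_univ_two] using h
  · simpa using h₁

/-- Matrices in the algebra generated by `σx` absorb the outer rotations. -/
lemma exists_eq_expISigmaX_mul_mul (θ θ' : ℝ) (x y : ℂ) :
    ∃ p q : ℂ, !![x, y; y, x] = expISigmaX θ * !![p, q; q, p] * expISigmaX θ' := by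
  have h : ∃ p q : ℂ,
      expISigmaX (-θ) * !![x, y; y, x] * expISigmaX (-θ') = !![p, q; q, p] := by
    refine ⟨(expISigmaX (-θ) * !![x, y; y, x] * expISigmaX (-θ')) 0 0,
      (expISigmaX (-θ) * !![x, y; y, x] * expISigmaX (-θ')) 0 1, ?_⟩
    rw [expISigmaX_eq, expISigmaX_eq, Matrix.mul_fin_two, Matrix.mul_fin_two]
    ext i j
    fin_cases i <;> fin_cases j <;> simp <;> ring
  obtain ⟨p, q, h⟩ := h
  refine ⟨p, q, ?_⟩
  rw [← h, ← Matrix.mul_assoc, ← Matrix.mul_assoc, expISigmaX_mul_neg, Matrix.one_mul,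
    Matrix.mul_assoc, expISigmaX_neg_mul, Matrix.mul_one]

/-- Factorization of the walk matrix when the step matrix has rank one. -/
lemma exists_dihedralWalk_eq_mul {za : ℂ} (hza : za ≠ 0) (zd ze : ℂ) (t t' : ℝ) :
    ∃ c p q : ℂ, c ≠ 0 ∧ ∀ w : ℂ,
      dihedralWalk za (-(t * t') * za) (Complex.I * t * za) (Complex.I * t' * za) zd ze w =
        expISigmaX (Real.arctan t') * !![c * star w + p, q; q, c * w + p] *
          expISigmaX (Real.arctan t) := by
  obtain ⟨p, q, h⟩ := exists_eq_expISigmaX_mul_mul (Real.arctan t') (Real.arctan t) ze zd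
  have hC : ∀ x : ℝ, (Real.cos (Real.arctan x) : ℂ) ≠ 0 := fun x =>
    Complex.ofReal_ne_zero.mpr (Real.cos_arctan_pos x).ne'
  have hS : ∀ x : ℝ, (Real.sin (Real.arctan x) : ℂ) = x * Real.cos (Real.arctan x) := fun x => by
    rw [← Complex.ofReal_mul]
    congr 1
    rw [← Real.tan_mul_cos (Real.cos_arctan_pos x).ne', Real.tan_arctan]
  refine ⟨za / (Real.cos (Real.arctan t') * Real.cos (Real.arctan t)), p, q,
    div_ne_zero hza (mul_ne_zero (hC t') (hC t)), fun w => ?_⟩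
  set c := za / (Real.cos (Real.arctan t') * Real.cos (Real.arctan t) : ℂ) with hc
  have hza' : za = c * (Real.cos (Real.arctan t') * Real.cos (Real.arctan t)) :=
    (div_mul_cancel₀ _ (mul_ne_zero (hC t') (hC t))).symm
  have hsplit : !![c * star w + p, q; q, c * w + p] =
      !![c * star w, 0; 0, c * w] + !![p, q; q, p] := by
    ext i j
    fin_cases i <;> fin_cases j <;> simp
  have hwalk : dihedralWalk za (-(t * t') * za) (Complex.I * t * za) (Complex.I * t' * za) zd ze w
      = dihedralWalk za (-(t * t') * za) (Complex.I * t * za) (Complex.I * t' * za) 0 0 w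
        + !![ze, zd; zd, ze] := by
    ext i j
    fin_cases i <;> fin_cases j <;> simp [dihedralWalk]
  rw [hwalk, hsplit, Matrix.mul_add, Matrix.add_mul, ← h, expISigmaX_eq, expISigmaX_eq,
    Matrix.mul_fin_two, Matrix.mul_fin_two, hS, hS, dihedralWalk]
  congr 1
  clear_value c
  subst hza'
  generalize (Real.cos (Real.arctan t') : ℂ) = x
  generalize (Real.cos (Real.arctan t) : ℂ) = y
  ext i j
  fin_cases i <;> fin_cases j <;> simp
  · linear_combination -(w * c * t * t' * x * y) * Complex.I_sq
  · ring
  · ring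
  · linear_combination -(starRingEnd ℂ w * c * t * t' * x * y) * Complex.I_sq

/-- The unitary `c (e^{-ik} ⊕ e^{ik}) + q σx` is a Dirac walk up to a phase. -/
lemma exists_eq_exp_smul_diracQW {c q : ℂ} (hc : c ≠ 0) (horth : c * star q + q * star c = 0)
    (hnorm : c * star c + q * star q = 1) :
    ∃ γ ν μ s : ℝ, 0 ≤ ν ∧ 0 ≤ μ ∧ ν ^ 2 + μ ^ 2 = 1 ∧ (s = 1 ∨ s = -1) ∧
      ∀ k : ℝ, !![c * Complex.exp (-(Complex.I * k)), q; q, c * Complex.exp (Complex.I * k)] =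
        Complex.exp (Complex.I * γ) • diracQW ν μ s k := by
  obtain ⟨r, hr⟩ := exists_eq_I_mul_real_mul hc horth
  obtain ⟨s, hs, hsr⟩ : ∃ s : ℝ, (s = 1 ∨ s = -1) ∧ s * |r| = r := by
    rcases le_total 0 r with h | h
    · exact ⟨1, Or.inl rfl, by rw [abs_of_nonneg h, one_mul]⟩
    · exact ⟨-1, Or.inr rfl, by rw [abs_of_nonpos h]; ring⟩
  have hq : ‖q‖ = |r| * ‖c‖ := by
    rw [hr]
    simp
  have hpolar : (‖c‖ : ℂ) * Complex.exp (Complex.I * c.arg) = c := by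
    rw [mul_comm Complex.I]
    exact Complex.norm_mul_exp_arg_mul_I c
  have hq' : q = Complex.exp (Complex.I * c.arg) * (Complex.I * s * (‖q‖ : ℝ)) := by
    have hsr' : (s : ℂ) * (|r| : ℝ) = r := by exact_mod_cast hsr
    rw [hq, Complex.ofReal_mul]
    nth_rewrite 1 [hr]
    linear_combination -Complex.I * r * hpolar
      - Complex.exp (Complex.I * c.arg) * Complex.I * ‖c‖ * hsr'
  refine ⟨c.arg, ‖c‖, ‖q‖, s, norm_nonneg c, norm_nonneg q, ?_, hs, fun k => ?_⟩
  · rw [Complex.star_def, Complex.mul_conj', Complex.mul_conj'] at hnorm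
    exact_mod_cast hnorm
  · ext i j
    fin_cases i <;> fin_cases j <;> simp [diracQW]
    · linear_combination -Complex.exp (-(Complex.I * k)) * hpolar
    · exact hq'
    · exact hq'
    · linear_combination -Complex.exp (Complex.I * k) * hpolar

/-- Classification of the coarse-grained scalar QWs on the infinite dihedral group: if the
walk matrix `A_k = e^{-ik}[[z_a, z_b],[z_c, z_ā]] + e^{ik}[[z_ā, z_c],[z_b, z_a]]
+ [[z_e, z_d],[z_d, z_e]]` (with `z_a, z_ā, z_b, z_c ≠ 0`) is unitary for every `k`, then
`A_k = e^{iγ} e^{iθσx} A_k^D e^{iθ'σx}` with `θ, θ' ∈ (−π/2,0) ∪ (0,π/2)`, `ν, μ ≥ 0`,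
`ν² + μ² = 1` and `s = ±1`. -/
theorem dihedral_scalar_qw_classification
    (za zaInv zb zc zd ze : ℂ)
    (hza : za ≠ 0) (hzaInv : zaInv ≠ 0) (hzb : zb ≠ 0) (hzc : zc ≠ 0)
    (A : ℝ → Matrix (Fin 2) (Fin 2) ℂ)
    (hA : ∀ k : ℝ, A k =
      Complex.exp (-(Complex.I * (k : ℂ))) • !![za, zb; zc, zaInv] +
        Complex.exp (Complex.I * (k : ℂ)) • !![zaInv, zc; zb, za] +
        !![ze, zd; zd, ze])
    (hU : ∀ k : ℝ, A k ∈ Matrix.unitaryGroup (Fin 2) ℂ) :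
    ∃ γ θ θ' ν μ s : ℝ,
      (θ ∈ Set.Ioo (-(Real.pi / 2)) 0 ∪ Set.Ioo 0 (Real.pi / 2)) ∧
      (θ' ∈ Set.Ioo (-(Real.pi / 2)) 0 ∪ Set.Ioo 0 (Real.pi / 2)) ∧
      0 ≤ ν ∧ 0 ≤ μ ∧ ν ^ 2 + μ ^ 2 = 1 ∧ (s = 1 ∨ s = -1) ∧
      ∀ k : ℝ, A k =
        Complex.exp (Complex.I * (γ : ℂ)) •
          (expISigmaX θ * diracQW ν μ s k * expISigmaX θ') := by
  have hA' : ∀ k : ℝ, A k =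
      dihedralWalk za zaInv zb zc zd ze (Complex.exp (Complex.I * k)) := fun k => by
    rw [hA, exp_neg_I_mul, dihedralWalk]
    ext i j
    fin_cases i <;> fin_cases j <;> simp
  have hW : ∀ w : ℂ, w * star w = 1 →
      dihedralWalk za zaInv zb zc zd ze w ∈ Matrix.unitaryGroup (Fin 2) ℂ := fun w hw => by
    obtain ⟨k, rfl⟩ := exists_exp_I_mul_eq hw
    exact hA' k ▸ hU k
  obtain ⟨t, t', rfl, rfl, rfl⟩ := exists_real_of_dihedralWalk_unitary hza hW
  have ht : t ≠ 0 := by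
    rintro rfl
    simp at hzb
  have ht' : t' ≠ 0 := by
    rintro rfl
    simp at hzc
  obtain ⟨c, p, q, hc, hfac⟩ := exists_dihedralWalk_eq_mul hza zd ze t t'
  obtain ⟨rfl, horth, hnorm⟩ := conditions_of_unitary (p := p) (q := q) hc fun w hw => by
    have h := hW w hw
    rw [hfac] at h
    have h' := mul_mem (mul_mem (expISigmaX_mem_unitaryGroup (-Real.arctan t')) h)
      (expISigmaX_mem_unitaryGroup (-Real.arctan t))
    rwa [← Matrix.mul_assoc, ← Matrix.mul_assoc, expISigmaX_neg_mul, Matrix.one_mul,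
      Matrix.mul_assoc, expISigmaX_mul_neg, Matrix.mul_one] at h'
  obtain ⟨γ, ν, μ, s, hν, hμ, hνμ, hs, hD⟩ := exists_eq_exp_smul_diracQW hc horth hnorm
  refine ⟨γ, Real.arctan t', Real.arctan t, ν, μ, s, arctan_mem_of_ne_zero ht',
    arctan_mem_of_ne_zero ht, hν, hμ, hνμ, hs, fun k => ?_⟩
  rw [hA', hfac, ← Matrix.smul_mul, ← Matrix.mul_smul, ← hD, exp_neg_I_mul, add_zero, add_zero]
end

section
/- Let A₊, A₋, A₀ be 2×2 complex matrices with A₊ ≠ 0 and A₋ ≠ 0, and for k ∈ ℝ set A_k = e^{−ik}·A₊ + e^{ik}·A₋ + A₀. Suppose A_k is unitary for every k ∈ ℝ, and suppose there exists a 2×2 unitary matrix P with P² = I, P ≠ I, P ≠ −I, such that P·A_k·P = A_{−k} for all k ∈ ℝ (parity invariance with nontrivially represented parity). Then there exist γ ∈ ℝ, a 2×2 unitary matrix U, an angle φ ∈ [−π/2, π/2], real numbers ν, μ ≥ 0 with ν² + μ² = 1, and a sign s ∈ {+1, −1} such that for all k ∈ ℝ: A_k = e^{iγ} · U · e^{iφσx}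 · A_k^D · U†, where σx = [[0,1],[1,0]], e^{iφσx} = (cos φ)·I + i(sin φ)·σx, and A_k^D = [[ν e^{−ik}, i s μ],[i s μ, ν e^{ik}]] is the one-dimensional Dirac quantum walk matrix. -/
open Matrix

/-- A trigonometric polynomial of degree two that vanishes identically has zero coefficients. -/
theorem trigPoly_coeff_eq_zero {X Y Z W V : ℂ}
    (h : ∀ k : ℝ, Complex.exp (-(Complex.I * k)) ^ 2 * X + Complex.exp (-(Complex.I * k)) * Y + Z +
      Complex.exp (Complex.I * k) * W + Complex.exp (Complex.I * k) ^ 2 * V = 0) :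
    X = 0 ∧ Y = 0 ∧ Z = 0 ∧ W = 0 ∧ V = 0 := by
  have hI : Complex.exp (Complex.I * ((Real.pi / 2 : ℝ) : ℂ)) = Complex.I := by
    rw [mul_comm]; push_cast; exact Complex.exp_pi_div_two_mul_I
  have hπ : Complex.exp (Complex.I * (Real.pi : ℂ)) = -1 := by
    rw [mul_comm]; exact Complex.exp_pi_mul_I
  have h8 : Complex.exp (Complex.I * ((Real.pi / 4 : ℝ) : ℂ)) ^ 2 = Complex.I := by
    rw [← Complex.exp_nat_mul]; refine Eq.trans ?_ hI; congr 1; push_cast; ring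
  have e0 := h 0
  have e1 := h Real.pi
  have e2 := h (Real.pi / 2)
  have e3 := h (-(Real.pi / 2))
  have e4 := h (Real.pi / 4)
  rw [Complex.ofReal_neg, mul_neg, neg_neg] at e3
  rw [Complex.exp_neg, inv_pow, h8] at e4
  rw [Complex.exp_neg, hI, Complex.inv_I] at e2 e3
  rw [Complex.exp_neg, hπ] at e1
  simp only [Complex.ofReal_zero, mul_zero, neg_zero, Complex.exp_zero] at e0
  norm_num at e0 e1 e2 e3 e4
  have hII := Complex.I_mul_I
  have hZ : Z = 0 := by linear_combination (e0 + e1 + e2 + e3) / 4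
  have hYW : Y + W = 0 := by linear_combination (e0 - e1) / 2
  have hYW' : Y - W = 0 := by
    linear_combination Complex.I * (e2 - e3) / 2 + (Y - W) * hII
  have hY : Y = 0 := by linear_combination (hYW + hYW') / 2
  have hW : W = 0 := by linear_combination (hYW - hYW') / 2
  have hXV : X + V = 0 := by linear_combination (e0 + e1) / 2 - hZ
  rw [hZ, hY, hW] at e4
  have hXV' : X - V = 0 := by
    linear_combination Complex.I * e4 + (X - V) * hII
  exact ⟨by linear_combination (hXV + hXV') / 2, hY, hZ, hW,
    by linear_combination (hXV - hXV') / 2⟩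

/-- The matrix version of `trigPoly_coeff_eq_zero`. -/
theorem matrix_trigPoly_coeff_eq_zero {X Y Z W V : Matrix (Fin 2) (Fin 2) ℂ}
    (h : ∀ k : ℝ, Complex.exp (-(Complex.I * k)) ^ 2 • X + Complex.exp (-(Complex.I * k)) • Y + Z +
      Complex.exp (Complex.I * k) • W + Complex.exp (Complex.I * k) ^ 2 • V = 0) :
    X = 0 ∧ Y = 0 ∧ Z = 0 ∧ W = 0 ∧ V = 0 := by
  have key (i j : Fin 2) := trigPoly_coeff_eq_zero
    (X := X i j) (Y := Y i j) (Z := Z i j) (W := W i j) (V := V i j)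
    (fun k => by simpa using congrFun (congrFun (h k) i) j)
  exact ⟨Matrix.ext fun i j => (key i j).1, Matrix.ext fun i j => (key i j).2.1,
    Matrix.ext fun i j => (key i j).2.2.1, Matrix.ext fun i j => (key i j).2.2.2.1,
    Matrix.ext fun i j => (key i j).2.2.2.2⟩

/-- The matrix `e^{-ik} A₊ + e^{ik} A₋ + A₀` of a walk in the wave-vector space. -/
noncomputable def walkMatrix (Ap Am A0 : Matrix (Fin 2) (Fin 2) ℂ) (k : ℝ) :
    Matrix (Fin 2) (Fin 2) ℂ :=
  Complex.exp (-(Complex.I * (k : ℂ))) • Ap + Complex.exp (Complex.I * (k : ℂ)) • Am + A0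

theorem star_exp_I_mul (k : ℝ) :
    star (Complex.exp (Complex.I * (k : ℂ))) = Complex.exp (-(Complex.I * (k : ℂ))) := by
  rw [Complex.star_def, ← Complex.exp_conj]; simp

theorem star_exp_neg_I_mul (k : ℝ) :
    star (Complex.exp (-(Complex.I * (k : ℂ)))) = Complex.exp (Complex.I * (k : ℂ)) := by
  rw [← star_exp_I_mul, star_star]

theorem walkMatrix_conjTranspose (Ap Am A0 : Matrix (Fin 2) (Fin 2) ℂ) (k : ℝ) :
    (walkMatrix Ap Am A0 k)ᴴ = walkMatrix Amᴴ Apᴴ A0ᴴ k := by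
  simp only [walkMatrix, conjTranspose_add, conjTranspose_smul, star_exp_I_mul,
    star_exp_neg_I_mul]
  abel

theorem walkMatrix_conj (S T Ap Am A0 : Matrix (Fin 2) (Fin 2) ℂ) (k : ℝ) :
    S * walkMatrix Ap Am A0 k * T = walkMatrix (S * Ap * T) (S * Am * T) (S * A0 * T) k := by
  simp [walkMatrix, mul_add, add_mul]

/-- Unitarity of a walk expressed through its transition matrices. -/
theorem walkMatrix_unitary_relations {Ap Am A0 : Matrix (Fin 2) (Fin 2) ℂ}
    (h : ∀ k : ℝ, walkMatrix Ap Am A0 k * (walkMatrix Ap Am A0 k)ᴴ = 1) :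
    Ap * Amᴴ = 0 ∧ Ap * A0ᴴ + A0 * Amᴴ = 0 ∧ Ap * Apᴴ + Am * Amᴴ + A0 * A0ᴴ = 1 := by
  have key := matrix_trigPoly_coeff_eq_zero (X := Ap * Amᴴ) (Y := Ap * A0ᴴ + A0 * Amᴴ)
    (Z := Ap * Apᴴ + Am * Amᴴ + A0 * A0ᴴ - 1) (W := A0 * Apᴴ + Am * A0ᴴ) (V := Am * Apᴴ)
    (fun k => by
      rw [← h k, walkMatrix_conjTranspose]
      have hz : Complex.exp (-(Complex.I * (k : ℂ))) * Complex.exp (Complex.I * (k : ℂ)) = 1 := by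
        rw [← Complex.exp_add]; simp
      simp only [walkMatrix]
      generalize Complex.exp (-(Complex.I * (k : ℂ))) = w at *
      generalize Complex.exp (Complex.I * (k : ℂ)) = z at *
      simp only [mul_add, add_mul, smul_mul_assoc, mul_smul_comm, smul_add, smul_smul, hz,
        mul_comm z w, one_smul, pow_two]
      abel)
  exact ⟨key.1, key.2.1, sub_eq_zero.1 key.2.2.1⟩

/-- The transition matrices are determined by the walk; in particular those of a parity
transformed walk are exchanged. -/
theorem walkMatrix_reflect {Ap Am A0 Bp Bm B0 : Matrix (Fin 2) (Fin 2) ℂ}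
    (h : ∀ k : ℝ, walkMatrix Ap Am A0 k = walkMatrix Bp Bm B0 (-k)) :
    Ap = Bm ∧ Am = Bp ∧ A0 = B0 := by
  have key := matrix_trigPoly_coeff_eq_zero (X := 0) (Y := Ap - Bm) (Z := A0 - B0)
    (W := Am - Bp) (V := 0) (fun k => by
      have hk := sub_eq_zero.2 (h k)
      simp only [walkMatrix, Complex.ofReal_neg, mul_neg, neg_neg] at hk
      simp only [smul_zero, zero_add, add_zero]
      rw [← hk]
      module)
  exact ⟨sub_eq_zero.1 key.2.1, sub_eq_zero.1 key.2.2.2.1, sub_eq_zero.1 key.2.2.1⟩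

/-- Polar form of a nonzero vector `(p, q)` with `Re (p̄ q) = 0`. -/
theorem exists_phase_angle {p q : ℂ} (hpq : p ≠ 0 ∨ q ≠ 0)
    (h : star p * q + star q * p = 0) :
    ∃ γ φ ν : ℝ, φ ∈ Set.Icc (-(Real.pi / 2)) (Real.pi / 2) ∧ 0 < ν ∧
      p = Complex.exp (Complex.I * γ) * (ν * Real.cos φ) ∧
      q = Complex.exp (Complex.I * γ) * (ν * (Complex.I * Real.sin φ)) := by
  by_cases hp : p = 0
  · have hq : q ≠ 0 := by simpa [hp] using hpq
    refine ⟨q.arg - Real.pi / 2, Real.pi / 2, ‖q‖,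
      ⟨by linarith [Real.pi_pos], le_rfl⟩, norm_pos_iff.2 hq, by simp [hp], ?_⟩
    have he : Complex.exp (Complex.I * ((q.arg - Real.pi / 2 : ℝ) : ℂ)) * Complex.I =
        Complex.exp (q.arg * Complex.I) := by
      conv_lhs => rw [← Complex.exp_pi_div_two_mul_I]
      rw [← Complex.exp_add]
      congr 1
      push_cast
      rw [Complex.exp_pi_div_two_mul_I]
      ring
    rw [Real.sin_pi_div_two, Complex.ofReal_one]
    linear_combination (-(‖q‖ : ℂ)) * he - Complex.norm_mul_exp_arg_mul_I q
  · obtain ⟨t, ht⟩ : ∃ t : ℝ, q = p * (Complex.I * t) := by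
      refine ⟨(q / p).im, ?_⟩
      have hre : (q / p).re = 0 := by
        have h' : q / p + star (q / p) = 0 := by
          have : star p ≠ 0 := star_ne_zero.2 hp
          rw [star_div₀]
          field_simp
          linear_combination h
        have := congrArg Complex.re h'
        rw [Complex.star_def, Complex.add_re, Complex.conj_re, Complex.zero_re] at this
        linarith
      have : q / p = Complex.I * ((q / p).im : ℂ) := by
        apply Complex.ext <;> simp [hre]
      rw [← this]
      field_simp
    have hs : 0 < Real.sqrt (1 + t ^ 2) := by positivity
    have hs' : (Real.sqrt (1 + t ^ 2) : ℂ) ≠ 0 := by exact_mod_cast hs.ne'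
    have hpol := Complex.norm_mul_exp_arg_mul_I p
    rw [mul_comm _ Complex.I] at hpol
    have hpc : p = Complex.exp (Complex.I * p.arg) *
        (((‖p‖ * Real.sqrt (1 + t ^ 2) : ℝ) : ℂ) * Real.cos (Real.arctan t)) := by
      rw [Real.cos_arctan]
      push_cast
      field_simp
      linear_combination -hpol
    refine ⟨p.arg, Real.arctan t, ‖p‖ * Real.sqrt (1 + t ^ 2),
      ⟨(Real.neg_pi_div_two_lt_arctan t).le, (Real.arctan_lt_pi_div_two t).le⟩,
      mul_pos (norm_pos_iff.2 hp) hs, hpc, ?_⟩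
    rw [Real.sin_arctan, ht]
    push_cast
    field_simp
    linear_combination (-(t : ℂ)) * hpol

/-- A walk whose parity is represented by `σx` and whose forward transition matrix is supported
on the first basis vector is a Dirac walk up to a phase and a rotation generated by `σx`. -/
theorem exists_dirac_form {p q x y : ℂ} (hpq : p ≠ 0 ∨ q ≠ 0)
    (h : ∀ k : ℝ, walkMatrix !![p, 0; q, 0] !![0, q; 0, p] !![x, y; y, x] k ∈
      Matrix.unitaryGroup (Fin 2) ℂ) :
    ∃ γ φ ν μ s : ℝ, φ ∈ Set.Icc (-(Real.pi / 2)) (Real.pi / 2) ∧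
      0 ≤ ν ∧ 0 ≤ μ ∧ ν ^ 2 + μ ^ 2 = 1 ∧ (s = 1 ∨ s = -1) ∧
      ∀ k : ℝ, walkMatrix !![p, 0; q, 0] !![0, q; 0, p] !![x, y; y, x] k =
        Complex.exp (Complex.I * (γ : ℂ)) • (expISigmaX φ * diracQW ν μ s k) := by
  obtain ⟨-, h1, h2⟩ := walkMatrix_unitary_relations
    (fun k => Matrix.mem_unitaryGroup_iff.1 (h k))
  obtain ⟨h3, -, -⟩ := walkMatrix_unitary_relations (fun k => by
    rw [← walkMatrix_conjTranspose, conjTranspose_conjTranspose]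
    exact Matrix.mem_unitaryGroup_iff'.1 (h k))
  have a01 := congrFun (congrFun h1 0) 1
  have a10 := congrFun (congrFun h1 1) 0
  have a11 := congrFun (congrFun h1 1) 1
  have n00 := congrFun (congrFun h2 0) 0
  have o := congrFun (congrFun h3 1) 0
  simp [Matrix.mul_apply, Matrix.vecMul, dotProduct, Fin.sum_univ_two] at a01 a10 a11 n00 o
  obtain ⟨γ, φ, ν, hφ, hν, hp, hq⟩ := exists_phase_angle hpq
    (by simp only [Complex.star_def]; linear_combination o)
  set g := Complex.exp (Complex.I * γ) with hg
  have hgg : g * (starRingEnd ℂ) g = 1 := by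
    rw [← Complex.star_def, hg, star_exp_I_mul, ← Complex.exp_add]; simp
  have hg0 : g ≠ 0 := Complex.exp_ne_zero _
  obtain ⟨X, rfl⟩ : ∃ X, x = g * X := ⟨x / g, by field_simp⟩
  obtain ⟨Y, rfl⟩ : ∃ Y, y = g * Y := ⟨y / g, by field_simp⟩
  have hν0 : (ν : ℂ) ≠ 0 := by exact_mod_cast hν.ne'
  have hcs : (Real.cos φ : ℂ) ^ 2 + (Real.sin φ : ℂ) ^ 2 = 1 := by
    exact_mod_cast Real.cos_sq_add_sin_sq φ
  subst hp hq
  simp only [map_mul, Complex.conj_ofReal, Complex.conj_I] at a01 a10 a11 n00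
  generalize hc' : (Real.cos φ : ℂ) = c at *
  generalize hs' : (Real.sin φ : ℂ) = d at *
  have hII := Complex.I_mul_I
  generalize hX' : (starRingEnd ℂ) X = X' at *
  generalize hY' : (starRingEnd ℂ) Y = Y' at *
  generalize (starRingEnd ℂ) g = g' at *
  have b1 : c * (Y' + Y) = 0 := by
    apply mul_left_cancel₀ hν0
    linear_combination a01 - (c * ν * (Y + Y')) * hgg
  have b2 : d * (X' - X) = 0 := by
    apply mul_left_cancel₀ (mul_ne_zero hν0 Complex.I_ne_zero)
    linear_combination a10 - (d * ν * Complex.I * (X' - X)) * hgg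
  have b3 : Complex.I * d * Y' + c * X = 0 := by
    apply mul_left_cancel₀ hν0
    linear_combination a11 - (ν * (Complex.I * d * Y' + c * X)) * hgg
  have b3' : c * X' - Complex.I * d * Y = 0 := by
    have := congrArg (starRingEnd ℂ) b3
    simp only [map_add, map_mul, map_zero, Complex.conj_I, ← hY', Complex.conj_conj, hX', ← hc',
      ← hs', Complex.conj_ofReal] at this
    rw [← hc', ← hs']
    linear_combination this
  have hx0 : c * X - Complex.I * d * Y = 0 := by
    linear_combination (-(c * X - Complex.I * d * Y)) * hcs +
      c * (c * b3 - Complex.I * d * b1) + d * (d * b3' - c * b2)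
  obtain ⟨m, hm⟩ : ∃ m : ℝ, c * Y - Complex.I * d * X = Complex.I * m := by
    refine ⟨(c * Y - Complex.I * d * X).im, ?_⟩
    have hre : (c * Y - Complex.I * d * X) + star (c * Y - Complex.I * d * X) = 0 := by
      simp only [Complex.star_def, map_sub, map_mul, Complex.conj_I, ← hc', ← hs',
        Complex.conj_ofReal, hX', hY']
      rw [hc', hs']
      linear_combination b1 + Complex.I * b2
    have hre' := congrArg Complex.re hre
    rw [Complex.star_def, Complex.add_re, Complex.conj_re, Complex.zero_re] at hre'
    apply Complex.ext
    · simp; simp at hre'; linarith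
    · simp
  have hXm : X = -(d * m) := by
    linear_combination (-X) * hcs + c * hx0 + Complex.I * d * hm + (d ^ 2 * X + d * m) * hII
  have hYm : Y = Complex.I * (c * m) := by
    linear_combination (-Y) * hcs + c * hm + Complex.I * d * hx0 + d ^ 2 * Y * hII
  have hXm' : X' = -(d * m) := by
    rw [← hX', hXm, ← hs', map_neg, map_mul, Complex.conj_ofReal, Complex.conj_ofReal]
  have hYm' : Y' = -(Complex.I * (c * m)) := by
    rw [← hY', hYm, ← hc', map_mul, map_mul, Complex.conj_I, Complex.conj_ofReal,
      Complex.conj_ofReal, neg_mul]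
  have hnorm : ν ^ 2 + m ^ 2 = 1 := by
    have : (ν : ℂ) ^ 2 + (m : ℂ) ^ 2 = 1 := by
      rw [hXm, hXm', hYm, hYm'] at n00
      linear_combination n00 - ((ν : ℂ) ^ 2 + m ^ 2) * hcs -
        (c ^ 2 + d ^ 2) * (ν ^ 2 + m ^ 2) * hgg +
          g * g' * (d ^ 2 * ν ^ 2 + c ^ 2 * m ^ 2) * hII
    exact_mod_cast this
  obtain ⟨s, hs, hsm⟩ : ∃ s : ℝ, (s = 1 ∨ s = -1) ∧ s * |m| = m := by
    rcases abs_choice m with hm | hm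
    · exact ⟨1, Or.inl rfl, by rw [hm, one_mul]⟩
    · exact ⟨-1, Or.inr rfl, by rw [hm]; ring⟩
  refine ⟨γ, φ, ν, |m|, s, hφ, hν.le, abs_nonneg m, by rwa [sq_abs], hs, fun k => ?_⟩
  have hsmC : (s : ℂ) * ((|m| : ℝ) : ℂ) = m := by exact_mod_cast hsm
  simp only [walkMatrix, expISigmaX, diracQW, sigmaX, mul_assoc, hsmC, hc', hs', hXm, hYm]
  rw [← hg]
  ext i j
  fin_cases i <;> fin_cases j <;> simp [Matrix.mul_apply, Fin.sum_univ_two]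
  · linear_combination (-(g * d * m)) * hII
  · ring
  · ring
  · linear_combination (-(g * d * m)) * hII

/-- For a reflection `P` and a nonzero matrix `M` with `M P Mᴴ = 0`, there is an orthonormal basis
in which `P` is `σx` and the second column of `M` vanishes. -/
theorem exists_adapted_basis {P M : Matrix (Fin 2) (Fin 2) ℂ}
    (hP : P ∈ Matrix.unitaryGroup (Fin 2) ℂ) (hPP : P * P = 1) (hM : M ≠ 0)
    (h : M * P * Mᴴ = 0) :
    ∃ U ∈ Matrix.unitaryGroup (Fin 2) ℂ, P * U = U * sigmaX ∧
      (M * U) 0 1 = 0 ∧ (M * U) 1 1 = 0 := by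
  obtain ⟨i, hi⟩ : ∃ i, M i ≠ 0 := Function.ne_iff.1 hM
  have hrow : M *ᵥ (P *ᵥ star (M i)) = 0 := by
    ext j
    have := congrFun (congrFun h j) i
    rw [mul_assoc] at this
    simpa [Matrix.mul_apply, Matrix.mulVec, dotProduct] using this
  obtain ⟨t, ht⟩ : ∃ t : ℝ, (t : ℂ) * t * (M i ⬝ᵥ star (M i)) = 1 := by
    have hpos : 0 < ‖M i 0‖ ^ 2 + ‖M i 1‖ ^ 2 := by
      by_contra! hle
      have h0 : ‖M i 0‖ = 0 := by nlinarith [sq_nonneg ‖M i 0‖, sq_nonneg ‖M i 1‖]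
      have h1 : ‖M i 1‖ = 0 := by nlinarith [sq_nonneg ‖M i 0‖, sq_nonneg ‖M i 1‖]
      refine hi (funext fun j => ?_)
      fin_cases j
      · exact norm_eq_zero.1 h0
      · exact norm_eq_zero.1 h1
    have hdot : M i ⬝ᵥ star (M i) = ((‖M i 0‖ ^ 2 + ‖M i 1‖ ^ 2 : ℝ) : ℂ) := by
      simp [dotProduct, Fin.sum_univ_two, Complex.mul_conj']
    refine ⟨(Real.sqrt (‖M i 0‖ ^ 2 + ‖M i 1‖ ^ 2))⁻¹, ?_⟩
    rw [hdot]
    norm_cast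
    rw [← mul_inv, Real.mul_self_sqrt hpos.le, inv_mul_cancel₀ hpos.ne']
  set b : Fin 2 → ℂ := (t : ℂ) • star (M i) with hb
  have hsb : star b = (t : ℂ) • M i := by simp [hb, star_smul]
  have hMPb : M *ᵥ (P *ᵥ b) = 0 := by rw [hb, mulVec_smul, mulVec_smul, hrow, smul_zero]
  have hbb : star b ⬝ᵥ b = 1 := by
    rw [hsb, hb, smul_dotProduct, dotProduct_smul, smul_smul, smul_eq_mul, ht]
  have hbPb : star b ⬝ᵥ (P *ᵥ b) = 0 := by
    rw [hsb, smul_dotProduct]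
    have : M i ⬝ᵥ (P *ᵥ b) = 0 := congrFun hMPb i
    rw [this, smul_zero]
  have hPbb : star (P *ᵥ b) ⬝ᵥ b = 0 := by
    rw [star_dotProduct, hbPb, star_zero]
  have hPbPb : star (P *ᵥ b) ⬝ᵥ (P *ᵥ b) = 1 := by
    rw [star_mulVec, ← dotProduct_mulVec, mulVec_mulVec, ← star_eq_conjTranspose,
      Matrix.mem_unitaryGroup_iff'.1 hP, one_mulVec, hbb]
  have hPPb : P *ᵥ (P *ᵥ b) = b := by rw [mulVec_mulVec, hPP, one_mulVec]
  refine ⟨(Matrix.of ![b, P *ᵥ b])ᵀ, ?_, ?_, congrFun hMPb 0, congrFun hMPb 1⟩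
  · rw [Matrix.mem_unitaryGroup_iff']
    ext m n
    fin_cases m <;> fin_cases n
    · exact hbb
    · exact hbPb
    · exact hPbb
    · exact hPbPb
  · ext m n
    fin_cases n
    · fin_cases m <;> simp [sigmaX, Matrix.mul_apply, Fin.sum_univ_two]
    · refine Eq.trans (congrFun hPPb m) ?_
      fin_cases m <;> simp [sigmaX, Matrix.mul_apply, Fin.sum_univ_two]

/-- Characterization of parity invariant quantum walks on `ℓ²(ℤ) ⊗ ℂ²` with coordination
number two: if `A_k = e^{-ik}A₊ + e^{ik}A₋ + A₀` (with `A₊, A₋ ≠ 0`) is unitary for all `k`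
and parity invariant with a nontrivially represented parity `P` (`P` unitary, `P² = I`,
`P ≠ ±I`, `P A_k P = A_{-k}`), then `A_k = e^{iγ} U e^{iφσx} A_k^D U†` for some unitary
`U`, `φ ∈ [−π/2, π/2]`, `ν, μ ≥ 0` with `ν² + μ² = 1` and `s = ±1`. -/
theorem parity_invariant_qw_classification
    (Ap Am A0 : Matrix (Fin 2) (Fin 2) ℂ) (hAp : Ap ≠ 0) (hAm : Am ≠ 0)
    (A : ℝ → Matrix (Fin 2) (Fin 2) ℂ)
    (hA : ∀ k : ℝ, A k =
      Complex.exp (-(Complex.I * (k : ℂ))) • Ap +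
        Complex.exp (Complex.I * (k : ℂ)) • Am + A0)
    (hU : ∀ k : ℝ, A k ∈ Matrix.unitaryGroup (Fin 2) ℂ)
    (hP : ∃ P : Matrix (Fin 2) (Fin 2) ℂ, P ∈ Matrix.unitaryGroup (Fin 2) ℂ ∧
      P * P = 1 ∧ P ≠ 1 ∧ P ≠ -1 ∧ ∀ k : ℝ, P * A k * P = A (-k)) :
    ∃ (γ : ℝ) (U : Matrix (Fin 2) (Fin 2) ℂ) (φ ν μ s : ℝ),
      U ∈ Matrix.unitaryGroup (Fin 2) ℂ ∧
      φ ∈ Set.Icc (-(Real.pi / 2)) (Real.pi / 2) ∧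
      0 ≤ ν ∧ 0 ≤ μ ∧ ν ^ 2 + μ ^ 2 = 1 ∧ (s = 1 ∨ s = -1) ∧
      ∀ k : ℝ, A k =
        Complex.exp (Complex.I * (γ : ℂ)) •
          (U * (expISigmaX φ * diracQW ν μ s k) * Uᴴ) := by
  obtain ⟨P, hPu, hPP, -, -, hPA⟩ := hP
  obtain rfl : A = walkMatrix Ap Am A0 := funext hA
  have hAk := walkMatrix_unitary_relations (fun k => Matrix.mem_unitaryGroup_iff.1 (hU k))
  obtain ⟨hApm, -, hA0⟩ := walkMatrix_reflect
    (fun k => (walkMatrix_conj P P Ap Am A0 k).symm.trans (hPA k))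
  have hPh : Pᴴ = P := by
    calc Pᴴ = Pᴴ * (P * P) := by rw [hPP, mul_one]
      _ = (star P * P) * P := by rw [star_eq_conjTranspose, mul_assoc]
      _ = P := by rw [Matrix.mem_unitaryGroup_iff'.1 hPu, one_mul]
  have hM : Ap * P * Apᴴ = 0 := by
    calc Ap * P * Apᴴ = Ap * (P * Ap * P)ᴴ * P := by
          simp only [conjTranspose_mul, hPh, mul_assoc, hPP, mul_one]
      _ = 0 := by rw [hApm, hAk.1, zero_mul]
  obtain ⟨U, hUu, hPU, h01, h11⟩ := exists_adapted_basis hPu hPP hAp hM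
  have hUU : U * Uᴴ = 1 := Matrix.mem_unitaryGroup_iff.1 hUu
  have hconj (X : Matrix (Fin 2) (Fin 2) ℂ) :
      Uᴴ * (P * X * P) * U = sigmaX * (Uᴴ * X * U) * sigmaX := by
    have hUP : Uᴴ * P = sigmaX * Uᴴ := by
      have hs : sigmaXᴴ = sigmaX := by
        ext i j; fin_cases i <;> fin_cases j <;> simp [sigmaX]
      have := congrArg conjTranspose hPU
      rwa [conjTranspose_mul, conjTranspose_mul, hPh, hs] at this
    calc Uᴴ * (P * X * P) * U = (Uᴴ * P) * X * (P * U) := by simp only [mul_assoc]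
      _ = sigmaX * (Uᴴ * X * U) * sigmaX := by rw [hUP, hPU]; simp only [mul_assoc]
  have hBp : ∃ p q, Uᴴ * Ap * U = !![p, 0; q, 0] := by
    refine ⟨(Uᴴ * Ap * U) 0 0, (Uᴴ * Ap * U) 1 0, ?_⟩
    have hcol (i : Fin 2) : (Uᴴ * Ap * U) i 1 = 0 := by
      rw [mul_assoc, Matrix.mul_apply, Fin.sum_univ_two, h01, h11, mul_zero, mul_zero, add_zero]
    ext i j
    fin_cases i <;> fin_cases j
    · rfl
    · exact hcol 0
    · rfl
    · exact hcol 1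
  obtain ⟨p, q, hBp⟩ := hBp
  have hBm : Uᴴ * Am * U = !![0, q; 0, p] := by
    rw [← hApm, hconj, hBp]
    ext i j; fin_cases i <;> fin_cases j <;> simp [sigmaX]
  have hB0 : ∃ x y, Uᴴ * A0 * U = !![x, y; y, x] := by
    refine ⟨(Uᴴ * A0 * U) 0 0, (Uᴴ * A0 * U) 0 1, ?_⟩
    have hcomm := hconj A0
    rw [hA0] at hcomm
    generalize Uᴴ * A0 * U = B at hcomm
    have h10 := congrFun (congrFun hcomm 1) 0
    have h11 := congrFun (congrFun hcomm 1) 1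
    simp [sigmaX, Matrix.mul_apply, Matrix.vecMul, dotProduct, Fin.sum_univ_two] at h10 h11
    ext i j
    fin_cases i <;> fin_cases j <;> simp [h10, h11]
  obtain ⟨x, y, hB0⟩ := hB0
  have hback (X : Matrix (Fin 2) (Fin 2) ℂ) : U * (Uᴴ * X * U) * Uᴴ = X := by
    calc U * (Uᴴ * X * U) * Uᴴ = (U * Uᴴ) * X * (U * Uᴴ) := by simp only [mul_assoc]
      _ = X := by rw [hUU, one_mul, mul_one]
  have hpq : p ≠ 0 ∨ q ≠ 0 := by
    by_contra! hpq
    apply hAp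
    rw [← hback Ap, hBp, hpq.1, hpq.2]
    ext i j; fin_cases i <;> fin_cases j <;> simp [Matrix.mul_apply, Fin.sum_univ_two]
  have hwalk (k : ℝ) : Uᴴ * walkMatrix Ap Am A0 k * U =
      walkMatrix !![p, 0; q, 0] !![0, q; 0, p] !![x, y; y, x] k := by
    rw [walkMatrix_conj, hBp, hBm, hB0]
  obtain ⟨γ, φ, ν, μ, s, hφ, hν, hμ, hνμ, hs, hD⟩ := exists_dirac_form hpq (fun k => by
    rw [← hwalk k]
    exact mul_mem (mul_mem (Unitary.star_mem hUu) (hU k)) hUu)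
  refine ⟨γ, U, φ, ν, μ, s, hUu, hφ, hν, hμ, hνμ, hs, fun k => ?_⟩
  rw [← hback (walkMatrix Ap Am A0 k), hwalk, hD, mul_smul_comm, smul_mul_assoc]
end

section
/- For all θ, θ' ∈ ℝ, all ν, μ ≥ 0 with ν² + μ² = 1, every sign s ∈ {+1, −1}, and every k ∈ ℝ: σx · (e^{iθσx} · A_k^D · e^{iθ'σx}) · σx = e^{iθσx} · A_{−k}^D · e^{iθ'σx}, where σx = [[0,1],[1,0]], e^{iθσx} = (cos θ)·I + i(sin θ)·σx, and A_k^D = [[ν e^{−ik}, i s μ],[i s μ, ν e^{ik}]]. Hence every coarse-grained scalar quantum walk on D∞ is parity invariant with parity represented by P = σx. -/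
open Matrix

theorem sigmaX_mul_sigmaX : sigmaX * sigmaX = 1 := by
  simp [sigmaX, Matrix.one_fin_two]

theorem sigmaX_commute_expISigmaX (θ : ℝ) : Commute sigmaX (expISigmaX θ) :=
  ((Commute.one_right _).smul_right _).add_right ((Commute.refl _).smul_right _)

theorem sigmaX_mul_diracQW (ν μ s k : ℝ) :
    sigmaX * diracQW ν μ s k = diracQW ν μ s (-k) * sigmaX := by
  simp [sigmaX, diracQW]

/-- Every coarse-grained scalar quantum walk on `D∞` is parity invariant with parity
represented by `σx`: conjugating `e^{iθσx} A_k^D e^{iθ'σx}` by `σx` replaces `k` by `-k`. -/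
theorem coarse_grained_scalar_qw_parity_invariant
    (θ θ' ν μ s : ℝ) (hν : 0 ≤ ν) (hμ : 0 ≤ μ) (hνμ : ν ^ 2 + μ ^ 2 = 1)
    (hs : s = 1 ∨ s = -1) (k : ℝ) :
    sigmaX * (expISigmaX θ * diracQW ν μ s k * expISigmaX θ') * sigmaX =
      expISigmaX θ * diracQW ν μ s (-k) * expISigmaX θ' := by
  calc
    sigmaX * (expISigmaX θ * diracQW ν μ s k * expISigmaX θ') * sigmaX
    _ = sigmaX * expISigmaX θ * diracQW ν μ s k * (expISigmaX θ' * sigmaX) := by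
      simp only [mul_assoc]
    _ = expISigmaX θ * (sigmaX * diracQW ν μ s k) * (sigmaX * expISigmaX θ') := by
      rw [(sigmaX_commute_expISigmaX θ).eq, (sigmaX_commute_expISigmaX θ').eq, mul_assoc _ sigmaX]
    _ = expISigmaX θ * diracQW ν μ s (-k) * (sigmaX * sigmaX) * expISigmaX θ' := by
      rw [sigmaX_mul_diracQW]
      simp only [mul_assoc]
    _ = expISigmaX θ * diracQW ν μ s (-k) * expISigmaX θ' := by
      rw [sigmaX_mul_sigmaX, mul_one]
end
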